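/- If (n, m, k, ℓ) are positive integers satisfying F^(k)_n · F^(k)_m = P_ℓ with k ≥ 3, n > m ≥ 3 and n ≥ k + 2, then |γ^ℓ · α^{−(n+m−2)} · (2√2 · f_k(α)²)^{−1} − 1| < 10/α^m, where γ = 1 + √2, α = α(k) is the dominant root of Ψ_k, and f_k(z) = (z − 1)/(2 + (k+1)(z − 2)). -/

import Mathlib

/-- The Pell sequence: `P 0 = 0`, `P 1 = 1`, `P (ℓ+2) = 2 P (ℓ+1) + P ℓ`. -/
def pell : ℕ → ℤ
  | 0 => 0
  | 1 => 1
  | n + 2 => 2 * pell (n + 1) + pell n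

/-- `kfib k j` is the `k`-generalized Fibonacci number `F⁽ᵏ⁾_n` with shifted index
`j = n + k - 2` (so `j = 0` corresponds to `n = 2 - k`).  Thus `kfib k j = 0` for
`0 ≤ j ≤ k - 2` (these are `F⁽ᵏ⁾_{2-k} = ⋯ = F⁽ᵏ⁾_0 = 0`), `kfib k (k - 1) = 1`
(this is `F⁽ᵏ⁾_1 = 1`), and every later term is the sum of the preceding `k` terms
(junk value `0` if `k < 2`). -/
def kfib (k : ℕ) : ℕ → ℤ
  | j =>
    if k < 2 then 0
    else if j < k - 1 then 0
    else if j = k - 1 then 1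
    else ∑ i ∈ Finset.range k, kfib k (j - 1 - i)
decreasing_by omega

lemma kfib_of_lt {k j : ℕ} (h : j < k - 1) : kfib k j = 0 := by
  rw [kfib]
  simp [h]

lemma kfib_pred {k : ℕ} (hk : 2 ≤ k) : kfib k (k - 1) = 1 := by
  rw [kfib]
  simp [not_lt.mpr hk]

lemma kfib_add {k : ℕ} (hk : 2 ≤ k) (j : ℕ) :
    kfib k (j + k) = ∑ i ∈ Finset.range k, kfib k (j + i) := by
  rw [kfib, if_neg (by omega), if_neg (by omega), if_neg (by omega),
    ← Finset.sum_range_reflect]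
  refine Finset.sum_congr rfl fun i hi => ?_
  rw [Finset.mem_range] at hi
  congr 1
  omega

/-- Binet's formula for the Pell numbers. -/
lemma pell_binet (ℓ : ℕ) :
    (pell ℓ : ℝ) * (2 * Real.sqrt 2) = (1 + Real.sqrt 2) ^ ℓ - (1 - Real.sqrt 2) ^ ℓ := by
  have h2 : Real.sqrt 2 ^ 2 = 2 := Real.sq_sqrt (by norm_num)
  induction ℓ using Nat.twoStepInduction with
  | zero => simp [pell]
  | one => simp [pell]; ring
  | more n ih₀ ih₁ =>
    rw [pell]
    push_cast
    linear_combination 2 * ih₁ + ih₀ -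
      ((1 + Real.sqrt 2) ^ n - (1 - Real.sqrt 2) ^ n) * h2

lemma two_sub_mul_pow {k : ℕ} {α : ℝ} (hroot : α ^ k = ∑ i ∈ Finset.range k, α ^ i) :
    (2 - α) * α ^ k = 1 := by
  have h := geom_sum_mul α k
  rw [← hroot] at h
  linear_combination -h

lemma lt_pow_of_root {k : ℕ} (hk : 2 ≤ k) {α : ℝ} (hα : 1 < α)
    (hroot : α ^ k = ∑ i ∈ Finset.range k, α ^ i) : (k : ℝ) < α ^ k := by
  rw [hroot]
  calc (k : ℝ) = ∑ _i ∈ Finset.range k, (1 : ℝ) := by simp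
    _ < _ := Finset.sum_lt_sum (fun i _ => one_le_pow₀ hα.le)
      ⟨1, Finset.mem_range.mpr (by omega), by simpa using hα⟩

/-- For a solution `x` of the `k`-step recurrence and `β` the inverse of a root of its
characteristic polynomial, this linear functional of the window starting at `n` scales by `β⁻¹`
when the window moves one step (`windowForm_succ`). -/
noncomputable def windowForm (k : ℕ) (β : ℝ) (x : ℕ → ℝ) (n : ℕ) : ℝ :=
  ∑ i ∈ Finset.range k, (∑ t ∈ Finset.range (i + 1), β ^ t) * x (n + i)

lemma geom_sum_inv_of_root {k : ℕ} {α : ℝ} (hα : 1 < α)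
    (hroot : α ^ k = ∑ i ∈ Finset.range k, α ^ i) :
    ∑ t ∈ Finset.range k, α⁻¹ ^ t = α := by
  have h0 : α ≠ 0 := by positivity
  have h1 : α⁻¹ - 1 ≠ 0 := by
    have := inv_lt_one_of_one_lt₀ hα
    linarith
  have h2 := two_sub_mul_pow hroot
  have h3 : (α ^ k)⁻¹ = 2 - α := (eq_inv_of_mul_eq_one_left h2).symm
  apply mul_right_cancel₀ h1
  rw [geom_sum_mul, inv_pow, h3]
  field_simp
  ring

lemma windowForm_succ {k : ℕ} {α : ℝ} (hα : 1 < α)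
    (hroot : α ^ k = ∑ i ∈ Finset.range k, α ^ i) {x : ℕ → ℝ}
    (hx : ∀ j, x (j + k) = ∑ i ∈ Finset.range k, x (j + i)) (n : ℕ) :
    windowForm k α⁻¹ x (n + 1) = α * windowForm k α⁻¹ x n := by
  have h0 : α ≠ 0 := by positivity
  have shift : windowForm k α⁻¹ x (n + 1) =
      ∑ i ∈ Finset.range (k + 1), (∑ t ∈ Finset.range i, α⁻¹ ^ t) * x (n + i) := by
    rw [Finset.sum_range_succ']
    simp [windowForm, add_assoc, add_comm 1]
  rw [shift, Finset.sum_range_succ, geom_sum_inv_of_root hα hroot, hx, Finset.mul_sum,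
    ← Finset.sum_add_distrib, windowForm, Finset.mul_sum]
  refine Finset.sum_congr rfl fun i _ => ?_
  rw [geom_sum_succ]
  field_simp

lemma windowForm_eq_zero {k : ℕ} {α : ℝ} (hα : 1 < α)
    (hroot : α ^ k = ∑ i ∈ Finset.range k, α ^ i) {x : ℕ → ℝ}
    (hx : ∀ j, x (j + k) = ∑ i ∈ Finset.range k, x (j + i))
    (h : windowForm k α⁻¹ x 0 = 0) (n : ℕ) : windowForm k α⁻¹ x n = 0 := by
  induction n with
  | zero => exact h
  | succ n ih => rw [windowForm_succ hα hroot hx, ih, mul_zero]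

lemma step_eq_two_mul_sub {k : ℕ} {x : ℕ → ℝ}
    (hx : ∀ j, x (j + k) = ∑ i ∈ Finset.range k, x (j + i)) (j : ℕ) :
    x (j + k + 1) = 2 * x (j + k) - x j := by
  have h1 := hx (j + 1)
  have h2 := Finset.sum_range_succ (fun i => x (j + i)) k
  rw [Finset.sum_range_succ', ← hx j] at h2
  have h3 : ∑ i ∈ Finset.range k, x (j + (i + 1)) = ∑ i ∈ Finset.range k, x (j + 1 + i) :=
    Finset.sum_congr rfl fun i _ => by congr 1; omega
  rw [h3, ← h1] at h2
  rw [add_right_comm] at h2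
  simp only [add_zero] at h2
  linarith

/-- A solution of the `k`-step recurrence with vanishing window form stays below `1` as long as
all earlier terms do: otherwise it would be positive and nondecreasing from there on. -/
lemma lt_one_of_forall_lt {k : ℕ} (hk : 2 ≤ k) {α : ℝ} (hα : 1 < α) {x : ℕ → ℝ}
    (hx : ∀ j, x (j + k) = ∑ i ∈ Finset.range k, x (j + i))
    (hform : ∀ n, windowForm k α⁻¹ x n = 0) {N : ℕ} (hN : k ≤ N)
    (hlt : ∀ j < N, x j < 1) : x N < 1 := by
  by_contra! hge
  have key : ∀ i, 1 ≤ x (N + i) ∧ ∀ j ≤ N + i, x j ≤ x (N + i) := by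
    intro i
    induction i with
    | zero =>
      refine ⟨hge, fun j hj => ?_⟩
      rcases hj.lt_or_eq with hj | rfl
      · exact (hlt j hj).le.trans hge
      · exact le_rfl
    | succ i ih =>
      obtain ⟨h1, h2⟩ := ih
      have hs := step_eq_two_mul_sub hx (N + i - k)
      rw [Nat.sub_add_cancel (by omega)] at hs
      have hp := h2 (N + i - k) (by omega)
      have hle : x (N + i) ≤ x (N + (i + 1)) := by
        rw [← add_assoc, hs]
        linarith
      refine ⟨h1.trans hle, fun j hj => ?_⟩
      rcases hj.lt_or_eq with hj | rfl
      · exact (h2 j (by omega)).trans hle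
      · exact le_rfl
  have hpos : 0 < windowForm k α⁻¹ x N := by
    refine Finset.sum_pos (fun i _ => mul_pos ?_ (by linarith [(key i).1]))
      ⟨0, Finset.mem_range.mpr (by omega)⟩
    exact Finset.sum_pos (fun t _ => by positivity) ⟨0, by simp⟩
  exact hpos.ne' (hform N)

lemma abs_lt_one_of_initial {k : ℕ} (hk : 2 ≤ k) {α : ℝ} (hα : 1 < α)
    (hroot : α ^ k = ∑ i ∈ Finset.range k, α ^ i) {x : ℕ → ℝ}
    (hx : ∀ j, x (j + k) = ∑ i ∈ Finset.range k, x (j + i))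
    (h : windowForm k α⁻¹ x 0 = 0) (hinit : ∀ j < k, |x j| < 1) (j : ℕ) : |x j| < 1 := by
  have hform := windowForm_eq_zero hα hroot hx h
  induction j using Nat.strong_induction_on with
  | _ j ih =>
    rcases lt_or_ge j k with hj | hj
    · exact hinit j hj
    · refine abs_lt.mpr ⟨?_, lt_one_of_forall_lt hk hα hx hform hj
        fun i hi => (abs_lt.mp (ih i hi)).2⟩
      have := lt_one_of_forall_lt (x := fun i => -x i) hk hα
        (fun i => by simp [hx i]) (fun n => by simpa [windowForm] using hform n) hj
        fun i hi => by linarith [(abs_lt.mp (ih i hi)).1]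
      linarith

/-- The coefficient `f_k(α)` of the dominant root in the Binet-type formula for `kfib k`. -/
noncomputable def kfibCoeff (k : ℕ) (α : ℝ) : ℝ := (α - 1) / (2 + (k + 1) * (α - 2))

lemma kfibCoeff_denom_gt {k : ℕ} (hk : 2 ≤ k) {α : ℝ} (hα : 1 < α)
    (hroot : α ^ k = ∑ i ∈ Finset.range k, α ^ i) :
    α - 1 < 2 + (k + 1) * (α - 2) := by
  have h1 := two_sub_mul_pow hroot
  have h2 := lt_pow_of_root hk hα hroot
  have h3 : 0 < α ^ k := by positivity
  have h4 : 0 < 2 - α := by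
    by_contra! h
    nlinarith
  nlinarith

lemma half_le_kfibCoeff {k : ℕ} (hk : 2 ≤ k) {α : ℝ} (hα : 1 < α)
    (hroot : α ^ k = ∑ i ∈ Finset.range k, α ^ i) : 1 / 2 ≤ kfibCoeff k α := by
  have hD := kfibCoeff_denom_gt hk hα hroot
  have h1 := two_sub_mul_pow hroot
  have h3 : 0 < α ^ k := by positivity
  have h4 : 0 < 2 - α := by
    by_contra! h
    nlinarith
  have h5 : (2 : ℝ) ≤ k := by exact_mod_cast hk
  rw [kfibCoeff, div_le_div_iff₀ (by norm_num) (by linarith)]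
  nlinarith

lemma kfibCoeff_lt_one {k : ℕ} (hk : 2 ≤ k) {α : ℝ} (hα : 1 < α)
    (hroot : α ^ k = ∑ i ∈ Finset.range k, α ^ i) : kfibCoeff k α < 1 := by
  have hD := kfibCoeff_denom_gt hk hα hroot
  rw [kfibCoeff, div_lt_one (by linarith)]
  exact hD

lemma sub_one_mul_geom_sum_inv {α : ℝ} (h0 : α ≠ 0) (i : ℕ) :
    (α - 1) * ((∑ t ∈ Finset.range (i + 1), α⁻¹ ^ t) * α ^ i) = α ^ (i + 1) - 1 := by
  induction i with
  | zero => simp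
  | succ i ih =>
    rw [geom_sum_succ, pow_succ α (i + 1)]
    rw [pow_succ] at ih ⊢
    field_simp at ih ⊢
    linear_combination ih

lemma sub_one_sq_mul_windowForm_pow {α : ℝ} (h0 : α ≠ 0) (N : ℕ) :
    (α - 1) ^ 2 * windowForm N α⁻¹ (fun j => α ^ j) 0 = α ^ (N + 1) - α - N * (α - 1) := by
  induction N with
  | zero => simp [windowForm]
  | succ N ih =>
    have h := sub_one_mul_geom_sum_inv h0 N
    rw [windowForm, Finset.sum_range_succ, ← windowForm]
    push_cast
    rw [zero_add]
    linear_combination ih + (α - 1) * h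

lemma coeff_mul_windowForm_pow {k : ℕ} (hk : 2 ≤ k) {α : ℝ} (hα : 1 < α)
    (hroot : α ^ k = ∑ i ∈ Finset.range k, α ^ i) :
    kfibCoeff k α * windowForm k α⁻¹ (fun j => α ^ j) 0 = α ^ k := by
  have h0 : α ≠ 0 := by positivity
  have h1 : α - 1 ≠ 0 := by linarith
  have hD := kfibCoeff_denom_gt hk hα hroot
  have hD0 : 2 + (k + 1) * (α - 2) ≠ 0 := by linarith
  have hW := sub_one_sq_mul_windowForm_pow h0 k
  have hp := two_sub_mul_pow hroot
  rw [kfibCoeff, div_mul_eq_mul_div, div_eq_iff hD0]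
  apply mul_left_cancel₀ h1
  linear_combination hW + (α + k * (α - 1)) * hp

/-- The distance of a `k`-Fibonacci number to its dominant term is less than one. -/
lemma abs_kfib_sub_lt_one {k : ℕ} (hk : 2 ≤ k) {α : ℝ} (hα : 1 < α)
    (hroot : α ^ k = ∑ i ∈ Finset.range k, α ^ i) (j : ℕ) :
    |(kfib k j : ℝ) - kfibCoeff k α * (α ^ j / α ^ (k - 1))| < 1 := by
  have h0 : α ≠ 0 := by positivity
  have hf1 := half_le_kfibCoeff hk hα hroot
  have hf2 := kfibCoeff_lt_one hk hα hroot
  have hk1 : α ^ k = α ^ (k - 1) * α := by rw [← pow_succ, Nat.sub_add_cancel (by omega)]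
  refine abs_lt_one_of_initial
    (x := fun j => (kfib k j : ℝ) - kfibCoeff k α * (α ^ j / α ^ (k - 1))) hk hα hroot ?_ ?_ ?_ j
  · intro j
    simp only [Finset.sum_sub_distrib, ← Finset.mul_sum, ← Finset.sum_div, pow_add, ← hroot]
    rw [kfib_add hk]
    push_cast
    rfl
  · have hF : windowForm k α⁻¹ (fun j => (kfib k j : ℝ)) 0 = α := by
      rw [windowForm, Finset.sum_eq_single (k - 1)]
      · rw [zero_add, kfib_pred hk, Nat.sub_add_cancel (by omega),
          geom_sum_inv_of_root hα hroot]
        simp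
      · intro i hi hne
        rw [Finset.mem_range] at hi
        rw [zero_add, kfib_of_lt (by omega)]
        simp
      · intro h
        exact absurd (Finset.mem_range.mpr (by omega)) h
    have hlin : windowForm k α⁻¹
        (fun j => (kfib k j : ℝ) - kfibCoeff k α * (α ^ j / α ^ (k - 1))) 0 =
        windowForm k α⁻¹ (fun j => (kfib k j : ℝ)) 0 -
          kfibCoeff k α * windowForm k α⁻¹ (fun j => α ^ j) 0 / α ^ (k - 1) := by
      simp only [windowForm, Finset.mul_sum, Finset.sum_div, ← Finset.sum_sub_distrib]
      exact Finset.sum_congr rfl fun i _ => by ring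
    rw [hlin, hF, coeff_mul_windowForm_pow hk hα hroot, hk1]
    field_simp
    ring
  · intro j hj
    rcases (show j ≤ k - 1 by omega).lt_or_eq with hj | rfl
    · have hq : α ^ j / α ^ (k - 1) < 1 := by
        rw [div_lt_one (by positivity)]
        exact pow_lt_pow_right₀ hα hj
      have hq0 : 0 < α ^ j / α ^ (k - 1) := by positivity
      simp only [kfib_of_lt hj, Int.cast_zero, zero_sub, abs_neg]
      rw [abs_of_nonneg (by positivity)]
      nlinarith
    · simp only [kfib_pred hk]
      rw [div_self (by positivity), abs_lt]
      constructor <;> push_cast <;> linarith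

lemma abs_kfib_shift_sub_lt_one {k : ℕ} (hk : 2 ≤ k) {α : ℝ} (hα : 1 < α)
    (hroot : α ^ k = ∑ i ∈ Finset.range k, α ^ i) {n : ℕ} (hn : 1 ≤ n) :
    |(kfib k (n + k - 2) : ℝ) - kfibCoeff k α * α ^ (n - 1)| < 1 := by
  have h := abs_kfib_sub_lt_one hk hα hroot (n + k - 2)
  rwa [show n + k - 2 = (n - 1) + (k - 1) by omega, pow_add, mul_div_assoc,
    div_self (by positivity), mul_one, ← show n + k - 2 = (n - 1) + (k - 1) by omega] at h

lemma abs_conj_pow_div_le_one (ℓ : ℕ) :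
    |(1 - Real.sqrt 2) ^ ℓ / (2 * Real.sqrt 2)| ≤ 1 := by
  have h1 : 1 ≤ Real.sqrt 2 := Real.one_le_sqrt.mpr (by norm_num)
  have h2 : Real.sqrt 2 ≤ 2 := Real.sqrt_le_iff.mpr (by norm_num)
  rw [abs_div, abs_pow, abs_of_pos (show 0 < 2 * Real.sqrt 2 by positivity),
    div_le_one (by positivity)]
  exact (pow_le_one₀ (abs_nonneg _) (abs_le.mpr ⟨by linarith, by linarith⟩)).trans (by linarith)

/-- If positive integers `(n, m, k, ℓ)` satisfy `F⁽ᵏ⁾_n · F⁽ᵏ⁾_m = P_ℓ` with `k ≥ 3`,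
`n > m ≥ 3` and `n ≥ k + 2`, then
`|γ^ℓ · α^(-(n+m-2)) · (2√2 f_k(α)²)⁻¹ - 1| < 10/α^m`, where `γ = 1 + √2`, `α` is
the dominant root of `Ψₖ`, and `f_k(z) = (z-1)/(2 + (k+1)(z-2))`. -/
theorem first_linear_form (n m k ℓ : ℕ) (hk : 3 ≤ k) (hm : 3 ≤ m) (hmn : m < n)
    (hn : k + 2 ≤ n) (hℓ : 0 < ℓ)
    (heq : kfib k (n + k - 2) * kfib k (m + k - 2) = pell ℓ)
    (α : ℝ) (hα : 1 < α) (hroot : α ^ k = ∑ i ∈ Finset.range k, α ^ i) :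
    |(1 + Real.sqrt 2) ^ ℓ * α ^ (-((n : ℤ) + m - 2)) *
        (2 * Real.sqrt 2 * ((α - 1) / (2 + (k + 1) * (α - 2))) ^ 2)⁻¹ - 1| <
      10 / α ^ m := by
  have hk2 : 2 ≤ k := by omega
  have h0 : 0 < α := by linarith
  have hu := abs_kfib_shift_sub_lt_one hk2 hα hroot (show 1 ≤ n by omega)
  have hv := abs_kfib_shift_sub_lt_one hk2 hα hroot (show 1 ≤ m by omega)
  have hf := half_le_kfibCoeff hk2 hα hroot
  have hw := abs_conj_pow_div_le_one ℓ
  have hα2 : α < 2 := by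
    have := two_sub_mul_pow hroot
    have : 0 < α ^ k := by positivity
    by_contra! h
    nlinarith
  have hmpow : α ^ m = α ^ (m - 1) * α := by rw [← pow_succ, Nat.sub_add_cancel (by omega)]
  have hAB : α ^ (m - 1) * α ≤ α ^ (n - 1) := by
    rw [← pow_succ]
    exact pow_le_pow_right₀ hα.le (by omega)
  have hA : 3 * α ≤ α ^ (n - 1) := by
    have h1 := lt_pow_of_root hk2 hα hroot
    have h2 : (3 : ℝ) ≤ k := by exact_mod_cast hk
    calc 3 * α ≤ α ^ k * α := by gcongr; linarith
      _ = α ^ (k + 1) := (pow_succ _ _).symm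
      _ ≤ α ^ (n - 1) := pow_le_pow_right₀ hα.le (by omega)
  have hz : α ^ (-((n : ℤ) + m - 2)) = (α ^ (n - 1) * α ^ (m - 1))⁻¹ := by
    rw [zpow_neg, ← pow_add, ← zpow_natCast]
    congr 2
    omega
  have hP : (kfib k (n + k - 2) : ℝ) * kfib k (m + k - 2) = pell ℓ := by exact_mod_cast heq
  have hB := pell_binet ℓ
  rw [← hP] at hB
  have hs : 0 < Real.sqrt 2 := by positivity
  rw [hz, hmpow, ← kfibCoeff]
  have hBpos : 0 < α ^ (m - 1) := by positivity
  have hApos : 0 < α ^ (n - 1) := by positivity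
  generalize kfibCoeff k α = f at *
  generalize α ^ (n - 1) = A at *
  generalize α ^ (m - 1) = B at *
  have hfpos : 0 < f := by linarith
  obtain ⟨u, hu'⟩ : ∃ u, u = (kfib k (n + k - 2) : ℝ) - f * A := ⟨_, rfl⟩
  obtain ⟨v, hv'⟩ : ∃ v, v = (kfib k (m + k - 2) : ℝ) - f * B := ⟨_, rfl⟩
  obtain ⟨w, hw'⟩ : ∃ w, w = (1 - Real.sqrt 2) ^ ℓ / (2 * Real.sqrt 2) := ⟨_, rfl⟩
  rw [← hu'] at hu
  rw [← hv'] at hv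
  rw [← hw'] at hw
  have hG : (1 + Real.sqrt 2) ^ ℓ = 2 * Real.sqrt 2 * ((f * A + u) * (f * B + v) + w) := by
    rw [hu', hv', hw']
    field_simp
    linear_combination -hB
  have heq' : (1 + Real.sqrt 2) ^ ℓ * (A * B)⁻¹ * (2 * Real.sqrt 2 * f ^ 2)⁻¹ - 1 =
      v / (f * B) + u / (f * A) + (u * v + w) / (f * A * (f * B)) := by
    rw [hG]
    field_simp
    ring
  have hfB : B / 2 ≤ f * B := by nlinarith
  have hfA : A / 2 ≤ f * A := by nlinarith
  have b1 : |v / (f * B)| ≤ 4 / (B * α) := by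
    rw [abs_div, abs_of_pos (by positivity : 0 < f * B)]
    calc |v| / (f * B) ≤ 1 / (B / 2) := by gcongr
      _ ≤ 4 / (B * α) := by
        rw [div_le_div_iff₀ (by positivity) (by positivity)]
        nlinarith
  have b2 : |u / (f * A)| ≤ 2 / (B * α) := by
    rw [abs_div, abs_of_pos (by positivity : 0 < f * A)]
    calc |u| / (f * A) ≤ 1 / (A / 2) := by gcongr
      _ = 2 / A := by field_simp
      _ ≤ 2 / (B * α) := by gcongr
  have b3 : |(u * v + w) / (f * A * (f * B))| ≤ 3 / (B * α) := by
    have huv : |u * v + w| ≤ 2 := by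
      have h1 : |u * v| ≤ 1 := by
        rw [abs_mul]
        exact mul_le_one₀ hu.le (abs_nonneg _) hv.le
      linarith [abs_add_le (u * v) w]
    rw [abs_div, abs_of_pos (by positivity : 0 < f * A * (f * B))]
    calc |u * v + w| / (f * A * (f * B)) ≤ 2 / (3 * α / 2 * (B / 2)) := by
          gcongr
          linarith
      _ ≤ 3 / (B * α) := by
        rw [div_le_div_iff₀ (by positivity) (by positivity)]
        nlinarith [mul_pos hBpos h0]
  rw [heq']
  calc _ ≤ |v / (f * B)| + |u / (f * A)| + |(u * v + w) / (f * A * (f * B))| := abs_add_three _ _ _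
    _ ≤ 4 / (B * α) + 2 / (B * α) + 3 / (B * α) := by gcongr
    _ = 9 / (B * α) := by ring
    _ < 10 / (B * α) := by gcongr; norm_num
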